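/- Let B be a block of the dual graph of an RNA secondary structure that represents a pseudoknot (B contains a vertex of degree at least 3). If the pseudoknot is recursive — i.e., the pseudoknot M_{i,j} occupying region [i,j] contains a pseudoknotted or regular region M_{k,l} with i < k < l < j such that there is no base pair (c,d) with d a position of M_{k,l} and c a position of M_{i,j} outside of M_{k,l} — then B has edge-connectivity exactly 2, i.e., the minimum number of edges whose deletion disconnects B equals 2. -/

import Mathlib

/-! ## Multigraphs, subgraphs, blocks, degrees, connectivity -/

/-- A multigraph on vertex type `V` with edge type `E`: each edge is assigned an
unordered pair of endpoints. -/
structure Multigraph (V E : Type) where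
  ends : E → Sym2 V

namespace Multigraph

variable {V E : Type}

/-- The degree of a vertex `u`: the number of edges incident at `u`. -/
noncomputable def degree (G : Multigraph V E) (u : V) : ℕ :=
  Set.ncard {e | u ∈ G.ends e}

/-- A subgraph of a multigraph: a set of vertices together with a set of edges
all of whose endpoints lie in the vertex set. -/
structure Subgraph (G : Multigraph V E) where
  verts : Set V
  edges : Set E
  ends_mem : ∀ e ∈ edges, ∀ v, v ∈ G.ends e → v ∈ verts

namespace Subgraph

variable {G : Multigraph V E}

/-- The degree of a vertex `u` in a subgraph `H`: the number of edges of `H`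
incident at `u`. -/
noncomputable def degree (H : G.Subgraph) (u : V) : ℕ :=
  Set.ncard {e ∈ H.edges | u ∈ G.ends e}

/-- One step along an edge of the subgraph `H`, avoiding the deleted edges `F`
and the deleted vertices `W`. -/
def Adj (H : G.Subgraph) (F : Set E) (W : Set V) (a b : V) : Prop :=
  a ∈ H.verts ∧ b ∈ H.verts ∧ a ∉ W ∧ b ∉ W ∧
    ∃ e ∈ H.edges, e ∉ F ∧ G.ends e = s(a, b)

/-- The subgraph `H` is connected after deleting the edges in `F` and the
vertices in `W`: any two remaining vertices are joined by a walk. -/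
def ConnectedAvoiding (H : G.Subgraph) (F : Set E) (W : Set V) : Prop :=
  ∀ u ∈ H.verts \ W, ∀ v ∈ H.verts \ W, Relation.ReflTransGen (H.Adj F W) u v

/-- The subgraph `H` is connected (and nonempty). -/
def Connected (H : G.Subgraph) : Prop :=
  H.verts.Nonempty ∧ H.ConnectedAvoiding ∅ ∅

/-- `w` is an articulation point of `H`: deleting `w` disconnects `H`. -/
def IsArticulation (H : G.Subgraph) (w : V) : Prop :=
  w ∈ H.verts ∧ ¬ H.ConnectedAvoiding ∅ {w}

/-- A block of `G`: a maximal connected subgraph without articulation points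
(maximal non-separable component). -/
def IsBlock (H : G.Subgraph) : Prop :=
  H.Connected ∧ (∀ w, ¬ H.IsArticulation w) ∧
    ∀ H' : G.Subgraph, H'.Connected → (∀ w, ¬ H'.IsArticulation w) →
      H.verts ⊆ H'.verts → H.edges ⊆ H'.edges →
      H.verts = H'.verts ∧ H.edges = H'.edges

/-- The subgraph `H` has edge-connectivity exactly `2`: it is connected, it
remains connected after deleting any single edge, but some two edges
disconnect it. -/
def EdgeConnTwo (H : G.Subgraph) : Prop :=
  H.Connected ∧ (∀ e : E, H.ConnectedAvoiding {e} ∅) ∧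
    ∃ e₁ ∈ H.edges, ∃ e₂ ∈ H.edges, e₁ ≠ e₂ ∧ ¬ H.ConnectedAvoiding {e₁, e₂} ∅

/-- `H` consists of a single edge together with its endpoints. -/
def IsSingleEdge (H : G.Subgraph) : Prop :=
  ∃ e, H.edges = {e} ∧ H.verts = {v | v ∈ G.ends e}

/-- `H` is a cycle: a connected graph in which every vertex has degree
exactly `2`. -/
def IsCycle (H : G.Subgraph) : Prop :=
  H.Connected ∧ ∀ v ∈ H.verts, H.degree v = 2

end Subgraph

end Multigraph

/-! ## RNA secondary structures, stems, segments and the dual (di)graph -/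

/-- An RNA secondary structure of length `n`: a set `pairs` of base pairs
`(i, j)` with `1 ≤ i < j ≤ n` in which every position occurs in at most one
base pair (a partial matching). -/
structure RNA (n : ℕ) where
  pairs : Finset (ℕ × ℕ)
  one_le : ∀ p ∈ pairs, 1 ≤ p.1
  fst_lt_snd : ∀ p ∈ pairs, p.1 < p.2
  le_length : ∀ p ∈ pairs, p.2 ≤ n
  matching : ∀ p ∈ pairs, ∀ q ∈ pairs, p ≠ q →
    p.1 ≠ q.1 ∧ p.1 ≠ q.2 ∧ p.2 ≠ q.1 ∧ p.2 ≠ q.2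

namespace RNA

variable {n : ℕ}

/-- Position `p` is paired (belongs to some base pair). -/
def Paired (R : RNA n) (p : ℕ) : Prop :=
  ∃ q, (p, q) ∈ R.pairs ∨ (q, p) ∈ R.pairs

/-- A stem of `R`: a maximal tuple of consecutively nested base pairs
`(i, j), (i+1, j-1), …, (i+r, j-r)` of `R`. -/
structure Stem (R : RNA n) where
  i : ℕ
  j : ℕ
  r : ℕ
  nested : ∀ k ≤ r, (i + k, j - k) ∈ R.pairs
  sep : i + r < j - r
  max_out : (i - 1, j + 1) ∉ R.pairs
  max_in : (i + r + 1, j - (r + 1)) ∉ R.pairs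

/-- Position `p` is occupied by the stem `S`. -/
def Stem.MemPos {R : RNA n} (S : Stem R) (p : ℕ) : Prop :=
  ∃ k ≤ S.r, p = S.i + k ∨ p = S.j - k

/-- `(a, b)` is one of the base pairs of the stem `S`. -/
def Stem.MemPair {R : RNA n} (S : Stem R) (a b : ℕ) : Prop :=
  ∃ k ≤ S.r, a = S.i + k ∧ b = S.j - k

/-- `S` is a super-stem of `T` (written `S > T` in the paper): the region
occupied by `T` is strictly contained inside the paired region of `S`. -/
def SuperStem {R : RNA n} (S T : Stem R) : Prop :=
  S.i + S.r < T.i ∧ T.j < S.j - S.r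

/-- A single-stranded segment running, 5' to 3', from the paired position `p`
to the next paired position `q`: all strictly intermediate positions are
unpaired. -/
def IsSegment (R : RNA n) (p q : ℕ) : Prop :=
  p < q ∧ R.Paired p ∧ R.Paired q ∧ ∀ t, p < t → t < q → ¬ R.Paired t

/-- An edge of the dual (di)graph of `R`: a single-stranded segment running
from an occurrence (position `p`) of stem `src` to an occurrence (position
`q`) of stem `tgt`, with self-loops (hairpins, `src = tgt`) deleted.  Read as
a directed edge it is directed from `src` to `tgt` (5' to 3'). -/
structure DualEdge (R : RNA n) where
  p : ℕ
  q : ℕ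
  src : Stem R
  tgt : Stem R
  seg : R.IsSegment p q
  mem_src : src.MemPos p
  mem_tgt : tgt.MemPos q
  ne : src ≠ tgt

/-- The dual graph of `R`: vertices are the stems of `R`, and each
single-stranded segment between occurrences of two distinct stems contributes
one edge between them. -/
def dualGraph (R : RNA n) : Multigraph (Stem R) (DualEdge R) :=
  ⟨fun e => s(e.src, e.tgt)⟩

/-- The weight of a directed edge of the dual digraph: the order (1st, 2nd, …)
in which the corresponding segment is reached along the primary sequence,
i.e. the number of segments starting no later than it. -/
noncomputable def DualEdge.weight {R : RNA n} (e : DualEdge R) : ℕ :=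
  Set.ncard {p' | ∃ q', R.IsSegment p' q' ∧ p' ≤ e.p}

end RNA

/-- The pseudoknot occupying the region `[i, j]` is recursive (Wong et al.):
it contains a pseudoknotted or regular region `[k, l]`, `i < k < l < j`
(a nonempty internal structure), such that there is no base pair `(c, d)`
with `d` a position of `[k, l]` and `c` a position of `[i, j]` external to
`[k, l]`. -/
def RNA.RecursivePK {n : ℕ} (R : RNA n) (i j : ℕ) : Prop :=
  ∃ k l : ℕ, i < k ∧ k < l ∧ l < j ∧
    (∃ a b : ℕ, (a, b) ∈ R.pairs ∧ k ≤ a ∧ b ≤ l) ∧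
    ∀ c d : ℕ, ((c, d) ∈ R.pairs ∨ (d, c) ∈ R.pairs) →
      k ≤ d → d ≤ l → i ≤ c → c ≤ j → k ≤ c ∧ c ≤ l

open Relation in
theorem aux_escape {α : Type} {r : α → α → Prop} {u v : α} (h : ReflTransGen r u v)
    (U : Set α) (hu : u ∈ U) (hv : v ∉ U) : ∃ a b, r a b ∧ a ∈ U ∧ b ∉ U := by
  induction h with
  | refl => exact absurd hu hv
  | tail hab hbc ih =>
    rename_i b c
    by_cases hb : b ∈ U
    · exact ⟨b, c, hbc, hb, hv⟩
    · exact ih hb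

theorem aux_mono {α : Type} {r s : α → α → Prop} {u v : α} (h : Relation.ReflTransGen r u v)
    (hrs : ∀ a b, r a b → s a b) : Relation.ReflTransGen s u v := by
  induction h with
  | refl => exact .refl
  | tail _ hbc ih => exact ih.tail (hrs _ _ hbc)

namespace RNA

variable {n : ℕ} {R : RNA n}

theorem Stem.memPos_iff (S : Stem R) (p : ℕ) :
    S.MemPos p ↔ (S.i ≤ p ∧ p ≤ S.i + S.r) ∨ (S.j - S.r ≤ p ∧ p ≤ S.j) := by
  have := S.sep
  constructor
  · rintro ⟨k, hk, h | h⟩ <;> omega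
  · rintro (h | h)
    · exact ⟨p - S.i, by omega, Or.inl (by omega)⟩
    · exact ⟨S.j - p, by omega, Or.inr (by omega)⟩

theorem Stem.paired (S : Stem R) {p : ℕ} (h : S.MemPos p) : R.Paired p := by
  obtain ⟨k, hk, h | h⟩ := h
  · exact ⟨S.j - k, Or.inl (h ▸ S.nested k hk)⟩
  · exact ⟨S.i + k, Or.inr (h ▸ S.nested k hk)⟩

theorem Stem.eq_of_pair {S T : Stem R} {k k' : ℕ} (hk : k ≤ S.r) (hk' : k' ≤ T.r)
    (h1 : S.i + k = T.i + k') (h2 : S.j - k = T.j - k') : S = T := by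
  have hs := S.sep
  have ht := T.sep
  have hkk : k = k' := by
    rcases lt_trichotomy k k' with h | h | h
    · exfalso
      apply S.max_out
      have := T.nested (k' - k - 1) (by omega)
      convert this using 2 <;> omega
    · exact h
    · exfalso
      apply T.max_out
      have := S.nested (k - k' - 1) (by omega)
      convert this using 2 <;> omega
  have hi : S.i = T.i := by omega
  have hj : S.j = T.j := by omega
  have hr : S.r = T.r := by
    rcases lt_trichotomy S.r T.r with h | h | h
    · exfalso
      apply S.max_in
      have := T.nested (S.r + 1) (by omega)
      convert this using 2 <;> omega
    · exact h
    · exfalso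
      apply T.max_in
      have := S.nested (T.r + 1) (by omega)
      convert this using 2 <;> omega
  cases S; cases T; simp_all

theorem Stem.eq_of_memPos {S T : Stem R} {p : ℕ} (hS : S.MemPos p) (hT : T.MemPos p) :
    S = T := by
  obtain ⟨k, hk, h⟩ := hS
  obtain ⟨k', hk', h'⟩ := hT
  have a := S.nested k hk
  have b := T.nested k' hk'
  have hs := S.sep
  have ht := T.sep
  by_cases hab : ((S.i + k, S.j - k) : ℕ × ℕ) = (T.i + k', T.j - k')
  · rw [Prod.mk.injEq] at hab
    exact Stem.eq_of_pair hk hk' hab.1 hab.2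
  · exfalso
    have := R.matching _ a _ b hab
    simp only at this
    omega

theorem exists_stem_pair {a b : ℕ} (h : (a, b) ∈ R.pairs) :
    ∃ S : Stem R, S.MemPos a ∧ S.MemPos b := by
  classical
  have hO : ∃ m, (a - (m + 1), b + (m + 1)) ∉ R.pairs := by
    refine ⟨a, fun hh => ?_⟩
    have := R.one_le _ hh
    simp at this
  have hI : ∃ m, (a + (m + 1), b - (m + 1)) ∉ R.pairs := by
    refine ⟨b, fun hh => ?_⟩
    have := R.fst_lt_snd _ hh
    simp at this
  obtain ⟨m, hm, hm'⟩ : ∃ m, (a - (m + 1), b + (m + 1)) ∉ R.pairs ∧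
      ∀ t ≤ m, (a - t, b + t) ∈ R.pairs := by
    refine ⟨Nat.find hO, Nat.find_spec hO, fun t ht => ?_⟩
    cases t with
    | zero => simpa using h
    | succ t => exact not_not.1 (Nat.find_min hO (m := t) (by omega))
  obtain ⟨r, hr, hr'⟩ : ∃ m, (a + (m + 1), b - (m + 1)) ∉ R.pairs ∧
      ∀ t ≤ m, (a + t, b - t) ∈ R.pairs := by
    refine ⟨Nat.find hI, Nat.find_spec hI, fun t ht => ?_⟩
    cases t with
    | zero => simpa using h
    | succ t => exact not_not.1 (Nat.find_min hI (m := t) (by omega))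
  have h1 := R.one_le _ (hm' m le_rfl)
  have h2 := R.fst_lt_snd _ (hr' r le_rfl)
  simp only at h1 h2
  let S : Stem R := {
    i := a - m
    j := b + m
    r := m + r
    nested := by
      intro k hk
      by_cases hkm : k ≤ m
      · have := hm' (m - k) (by omega)
        convert this using 2 <;> omega
      · have := hr' (k - m) (by omega)
        convert this using 2 <;> omega
    sep := by omega
    max_out := by
      convert hm using 3 <;> omega
    max_in := by
      intro hh
      apply hr
      convert hh using 2 <;> omega }
  refine ⟨S, (S.memPos_iff a).2 (Or.inl ?_), (S.memPos_iff b).2 (Or.inr ?_)⟩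
  · show a - m ≤ a ∧ a ≤ a - m + (m + r)
    omega
  · show b + m - (m + r) ≤ b ∧ b ≤ b + m
    omega

theorem exists_stem {p : ℕ} (h : R.Paired p) : ∃ S : Stem R, S.MemPos p := by
  obtain ⟨q, h | h⟩ := h
  · obtain ⟨S, h1, h2⟩ := exists_stem_pair h
    exact ⟨S, h1⟩
  · obtain ⟨S, h1, h2⟩ := exists_stem_pair h
    exact ⟨S, h2⟩

theorem DualEdge.eq_of_straddle {e f : DualEdge R} {x : ℕ} (he : e.p < x ∧ x ≤ e.q)
    (hf : f.p < x ∧ x ≤ f.q) : e = f := by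
  have hp : e.p = f.p := by
    rcases lt_trichotomy e.p f.p with h | h | h
    · exact absurd f.seg.2.1 (e.seg.2.2.2 _ h (by omega))
    · exact h
    · exact absurd e.seg.2.1 (f.seg.2.2.2 _ h (by omega))
  have hq : e.q = f.q := by
    rcases lt_trichotomy e.q f.q with h | h | h
    · exact absurd e.seg.2.2.1 (f.seg.2.2.2 _ (by omega) h)
    · exact h
    · exact absurd f.seg.2.2.1 (e.seg.2.2.2 _ (by omega) h)
  have hs : e.src = f.src := Stem.eq_of_memPos e.mem_src (hp ▸ f.mem_src)
  have ht : e.tgt = f.tgt := Stem.eq_of_memPos e.mem_tgt (hq ▸ f.mem_tgt)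
  cases e; cases f; simp_all

theorem bridgeless (B : Multigraph.Subgraph R.dualGraph) (hc : B.Connected)
    (ha : ∀ w, ¬ B.IsArticulation w) (hPK : ∃ u ∈ B.verts, 3 ≤ B.degree u)
    (e : DualEdge R) : B.ConnectedAvoiding {e} ∅ := by
  have key : ∀ x y, B.Adj ∅ ∅ x y → Relation.ReflTransGen (B.Adj {e} ∅) x y := by
    rintro x y ⟨hx, hy, -, -, f, hf, -, hends⟩
    by_cases hfe : f = e
    swap
    · exact Relation.ReflTransGen.single ⟨hx, hy, by simp, by simp, f, hf, hfe, hends⟩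
    subst hfe
    have hxy : x ≠ y := by
      rintro rfl
      have h1 : s(f.src, f.tgt) = s(x, x) := hends
      have := f.ne
      simp at h1
      exact this (h1.1.trans h1.2.symm)
    have hav : ∀ w, w = x ∨ w = y → ∀ a b, B.Adj ∅ {w} a b → B.Adj {f} ∅ a b := by
      rintro w hw a b ⟨h1, h2, h3, h4, g, hg, -, hge⟩
      refine ⟨h1, h2, by simp, by simp, g, hg, ?_, hge⟩
      rintro rfl
      rw [hends] at hge
      simp at h3 h4 hge
      grind
    by_cases hz : ∃ z ∈ B.verts, z ≠ x ∧ z ≠ y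
    · obtain ⟨z, hzB, hzx, hzy⟩ := hz
      have hX : B.ConnectedAvoiding ∅ {x} := by
        by_contra h; exact ha x ⟨hx, h⟩
      have hY : B.ConnectedAvoiding ∅ {y} := by
        by_contra h; exact ha y ⟨hy, h⟩
      have t1 := hY x ⟨hx, hxy⟩ z ⟨hzB, hzy⟩
      have t2 := hX z ⟨hzB, hzx⟩ y ⟨hy, hxy.symm⟩
      exact (aux_mono t1 (hav y (Or.inr rfl))).trans (aux_mono t2 (hav x (Or.inl rfl)))
    · push Not at hz
      obtain ⟨u, hu, hd⟩ := hPK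
      obtain ⟨g, hg, hgf⟩ : ∃ g ∈ B.edges, g ≠ f := by
        by_contra hcon
        push Not at hcon
        have : {e ∈ B.edges | u ∈ R.dualGraph.ends e} ⊆ {f} := fun g hg => hcon g hg.1
        have := Set.ncard_le_ncard this
        rw [Set.ncard_singleton] at this
        unfold Multigraph.Subgraph.degree at hd
        omega
      have m1 : g.src ∈ B.verts := B.ends_mem g hg _ (Sym2.mem_mk_left _ _)
      have m2 : g.tgt ∈ B.verts := B.ends_mem g hg _ (Sym2.mem_mk_right _ _)
      have hne := g.ne
      have h1 := hz _ m1
      have h2 := hz _ m2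
      refine Relation.ReflTransGen.single ⟨hx, hy, by simp, by simp, g, hg, hgf, ?_⟩
      show s(g.src, g.tgt) = s(x, y)
      rw [Sym2.eq_iff]
      grind
  intro u hu v hv
  have := hc.2 u hu v hv
  induction this with
  | refl => exact .refl
  | tail hab hbc ih => exact (ih ⟨hbc.1, by simp⟩).trans (key _ _ hbc)

/-- The interval cut lemma. -/
theorem interval_cut (B : Multigraph.Subgraph R.dualGraph) (hc : B.Connected)
    (ha : ∀ w, ¬ B.IsArticulation w) (hPK : ∃ u ∈ B.verts, 3 ≤ B.degree u)
    (x y : ℕ) (U : Set (Stem R))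
    (hin : ∀ S ∈ B.verts, S ∈ U → ∀ p, S.MemPos p → x ≤ p ∧ p ≤ y)
    (hout : ∀ S ∈ B.verts, S ∉ U → ∀ p, S.MemPos p → ¬ (x ≤ p ∧ p ≤ y))
    (h1 : ∃ S ∈ B.verts, S ∈ U) (h2 : ∃ S ∈ B.verts, S ∉ U) : B.EdgeConnTwo := by
  have hb := bridgeless B hc ha hPK
  refine ⟨hc, hb, ?_⟩
  obtain ⟨S, hS, hSU⟩ := h1
  obtain ⟨T, hT, hTU⟩ := h2
  have cross : ∀ F : Set (DualEdge R), B.ConnectedAvoiding F ∅ → ∃ e ∈ B.edges, e ∉ F ∧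
      ((e.p < x ∧ x ≤ e.q) ∨ (e.p < y + 1 ∧ y + 1 ≤ e.q)) := by
    intro F hF
    obtain ⟨a, b, ⟨hab1, hab2, -, -, e, he, heF, hends⟩, haU, hbU⟩ :=
      aux_escape (hF S ⟨hS, by simp⟩ T ⟨hT, by simp⟩) U hSU hTU
    refine ⟨e, he, heF, ?_⟩
    have h3 : s(e.src, e.tgt) = s(a, b) := hends
    have hpq := e.seg.1
    rw [Sym2.eq_iff] at h3
    rcases h3 with ⟨rfl, rfl⟩ | ⟨rfl, rfl⟩
    · have := hin _ hab1 haU _ e.mem_src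
      have := hout _ hab2 hbU _ e.mem_tgt
      omega
    · have := hin _ hab1 haU _ e.mem_tgt
      have := hout _ hab2 hbU _ e.mem_src
      omega
  obtain ⟨e₁, he₁, -, hs₁⟩ := cross ∅ hc.2
  obtain ⟨e₂, he₂, hn, hs₂⟩ := cross {e₁} (hb e₁)
  have hne : e₁ ≠ e₂ := fun h => hn (by simp [h])
  refine ⟨e₁, he₁, e₂, he₂, hne, fun hcon => ?_⟩
  obtain ⟨f, hf, hfn, hs⟩ := cross _ hcon
  simp only [Set.mem_insert_iff, Set.mem_singleton_iff, not_or] at hfn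
  rcases hs₁ with hs₁ | hs₁ <;> rcases hs₂ with hs₂ | hs₂ <;> rcases hs with hs | hs <;>
    first
    | exact hne (DualEdge.eq_of_straddle hs₁ hs₂)
    | exact hfn.1 (DualEdge.eq_of_straddle hs hs₁)
    | exact hfn.2 (DualEdge.eq_of_straddle hs hs₂)

theorem stem_case (B : Multigraph.Subgraph R.dualGraph) (hc : B.Connected)
    (ha : ∀ w, ¬ B.IsArticulation w) (hPK : ∃ u ∈ B.verts, 3 ≤ B.degree u)
    (S : Stem R) (hS : S ∈ B.verts)
    (h : ∀ T ∈ B.verts, T ≠ S → (∀ p, T.MemPos p → S.i + S.r < p ∧ p < S.j - S.r) ∨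
      (∀ p, T.MemPos p → p < S.i ∨ S.j < p)) : B.EdgeConnTwo := by
  have hsep := S.sep
  by_cases hU : ∃ T ∈ B.verts, T ≠ S ∧ (∀ p, T.MemPos p → S.i + S.r < p ∧ p < S.j - S.r)
  · refine interval_cut B hc ha hPK (S.i + S.r + 1) (S.j - S.r - 1)
      {T | T ≠ S ∧ (∀ p, T.MemPos p → S.i + S.r < p ∧ p < S.j - S.r)} ?_ ?_ hU
      ⟨S, hS, by simp⟩
    · rintro T hT ⟨-, hT2⟩ p hp
      have := hT2 p hp
      omega
    · intro T hT hTU p hp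
      by_cases hTS : T = S
      · subst hTS
        rw [Stem.memPos_iff] at hp
        omega
      · rcases h T hT hTS with h' | h'
        · exact absurd ⟨hTS, h'⟩ hTU
        · have := h' p hp
          omega
  · refine interval_cut B hc ha hPK S.i S.j {S} ?_ ?_ ⟨S, hS, rfl⟩ ?_
    · rintro T hT rfl p hp
      rw [Stem.memPos_iff] at hp
      omega
    · intro T hT hTS p hp
      rcases h T hT hTS with h' | h'
      · exact absurd ⟨T, hT, hTS, h'⟩ hU
      · have := h' p hp
        omega
    · obtain ⟨u, hu, hd⟩ := hPK
      have : {e ∈ B.edges | u ∈ R.dualGraph.ends e}.Nonempty := by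
        apply Set.nonempty_of_ncard_ne_zero
        unfold Multigraph.Subgraph.degree at hd
        omega
      obtain ⟨g, hg, -⟩ := this
      by_cases hgs : g.src = S
      · exact ⟨g.tgt, B.ends_mem g hg _ (Sym2.mem_mk_right _ _), fun h => g.ne (hgs.trans h.symm)⟩
      · exact ⟨g.src, B.ends_mem g hg _ (Sym2.mem_mk_left _ _), hgs⟩

/-- Simple graph of segments inside `[x, y]`. -/
def segGraph (R : RNA n) (x y : ℕ) : SimpleGraph (Stem R) where
  Adj a b := ∃ e : DualEdge R, x ≤ e.p ∧ e.q ≤ y ∧ R.dualGraph.ends e = s(a, b)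
  symm := ⟨by
    rintro a b ⟨e, h1, h2, h3⟩
    exact ⟨e, h1, h2, by rw [h3, Sym2.eq_swap]⟩⟩
  loopless := ⟨by
    rintro a ⟨e, h1, h2, h3⟩
    have h4 : s(e.src, e.tgt) = s(a, a) := h3
    have := e.ne
    simp at h4
    exact this (h4.1.trans h4.2.symm)⟩

theorem segGraph_reachable {x y : ℕ} {S : Stem R} (hS : S.MemPos x) (p : ℕ) :
    x ≤ p → p ≤ y → ∀ T : Stem R, T.MemPos p → (segGraph R x y).Reachable S T := by
  classical
  induction p using Nat.strong_induction_on with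
  | _ p ih =>
    intro hxp hpy T hT
    rcases eq_or_lt_of_le hxp with rfl | hlt
    · rw [Stem.eq_of_memPos hS hT]
    · set p' := Nat.findGreatest (fun t => R.Paired t) (p - 1) with hp'
      have hx : R.Paired x := S.paired hS
      have h1 : x ≤ p' := Nat.le_findGreatest (by omega) hx
      have h2 : R.Paired p' := Nat.findGreatest_spec (P := fun t => R.Paired t) (m := x) (by omega) hx
      have h3 : p' ≤ p - 1 := Nat.findGreatest_le _
      have h4 : ∀ t, p' < t → t < p → ¬ R.Paired t := fun t ht1 ht2 =>
        Nat.findGreatest_is_greatest ht1 (by omega)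
      obtain ⟨T', hT'⟩ := exists_stem h2
      have r := ih p' (by omega) h1 (by omega) T' hT'
      by_cases hTT : T' = T
      · exact hTT ▸ r
      · refine r.trans (SimpleGraph.Adj.reachable ?_)
        exact ⟨⟨p', p, T', T, ⟨by omega, h2, T.paired hT, h4⟩, hT', hT, hTT⟩, h1, hpy, rfl⟩

theorem adj_symm {B : Multigraph.Subgraph R.dualGraph} {F : Set (DualEdge R)} {W : Set (Stem R)}
    {a b : Stem R} (h : B.Adj F W a b) : B.Adj F W b a := by
  obtain ⟨h1, h2, h3, h4, e, he, hF, hh⟩ := h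
  exact ⟨h2, h1, h4, h3, e, he, hF, by rw [hh, Sym2.eq_swap]⟩

/-- Adding an ear to a block contradicts maximality. -/
theorem ear {x y : ℕ} (B : Multigraph.Subgraph R.dualGraph) (hB : B.IsBlock)
    {w₁ w₂ : Stem R} (h₁ : w₁ ∈ B.verts) (h₂ : w₂ ∈ B.verts)
    (P : (segGraph R x y).Walk w₁ w₂) (hP : P.IsPath) : ∀ v ∈ P.support, v ∈ B.verts := by
  classical
  let H : Multigraph.Subgraph R.dualGraph := {
    verts := B.verts ∪ {v | v ∈ P.support}
    edges := B.edges ∪ {e | R.dualGraph.ends e ∈ P.edges}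
    ends_mem := by
      rintro e (he | he) v hv
      · exact Or.inl (B.ends_mem e he v hv)
      · exact Or.inr (SimpleGraph.Walk.mem_support_of_mem_edges he hv) }
  have hmono : ∀ W a b, B.Adj ∅ W a b → H.Adj ∅ W a b := by
    rintro W a b ⟨k1, k2, k3, k4, e, he, k5, k6⟩
    exact ⟨Or.inl k1, Or.inl k2, k3, k4, e, Or.inl he, k5, k6⟩
  -- a walk inside P avoiding W
  have hwalk : ∀ (W : Set (Stem R)) {a b : Stem R} (Q : (segGraph R x y).Walk a b),
      (∀ v ∈ Q.support, v ∈ P.support) → (∀ e ∈ Q.edges, e ∈ P.edges) →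
      (∀ v ∈ Q.support, v ∉ W) → Relation.ReflTransGen (H.Adj ∅ W) a b := by
    intro W a b Q
    induction Q with
    | nil => intros; exact .refl
    | cons hadj Q ih =>
      intro q1 q2 q3
      simp only [SimpleGraph.Walk.support_cons, List.mem_cons, forall_eq_or_imp,
        SimpleGraph.Walk.edges_cons] at q1 q2 q3
      refine Relation.ReflTransGen.head ?_ (ih q1.2 q2.2 q3.2)
      have hst := Q.start_mem_support
      obtain ⟨e, -, -, he⟩ := hadj
      exact ⟨Or.inr q1.1, Or.inr (q1.2 _ hst), q3.1, q3.2 _ hst, e,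
        Or.inr (by show _ ∈ P.edges; rw [he]; exact q2.1), by simp, he⟩
  have hsymm : ∀ W a b, Relation.ReflTransGen (H.Adj ∅ W) a b →
      Relation.ReflTransGen (H.Adj ∅ W) b a := by
    intro W a b h
    induction h with
    | refl => exact .refl
    | tail _ hbc ih => exact Relation.ReflTransGen.head (adj_symm hbc) ih
  have hconn : ∀ W, B.ConnectedAvoiding ∅ W →
      (∀ v ∈ P.support, v ∉ W → (∀ t ∈ (W : Set (Stem R)), ∀ t' ∈ W, t = t')) →
      H.ConnectedAvoiding ∅ W := by
    intro W hBW hsub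
    have reach : ∀ v ∈ H.verts \ W, ∃ b ∈ B.verts \ W, Relation.ReflTransGen (H.Adj ∅ W) v b := by
      rintro v ⟨hv | hv, hvW⟩
      · exact ⟨v, ⟨hv, hvW⟩, .refl⟩
      · have hv' : v ∈ P.support := hv
        have hspec := P.take_spec hv'
        have hcase : (∀ t ∈ (P.takeUntil v hv').support, t ∉ W) ∨
            (∀ t ∈ (P.dropUntil v hv').support, t ∉ W) := by
          by_contra hcon
          push Not at hcon
          obtain ⟨⟨t, ht, htW⟩, t', ht', htW'⟩ := hcon
          obtain rfl := hsub v hv' hvW t htW t' htW'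
          have hnd := hP.support_nodup
          rw [← hspec, SimpleGraph.Walk.support_append, List.nodup_append] at hnd
          have htv : t ≠ v := fun h => hvW (h ▸ htW)
          rw [SimpleGraph.Walk.mem_support_iff] at ht'
          rcases ht' with ht' | ht'
          · exact htv ht'
          · exact hnd.2.2 t ht t ht' rfl
        rcases hcase with hcase | hcase
        · refine ⟨w₁, ⟨h₁, hcase _ (SimpleGraph.Walk.start_mem_support _)⟩, hsymm _ _ _ ?_⟩
          exact hwalk W _ (fun t ht => P.support_takeUntil_subset_support hv' ht)
            (fun t ht => P.edges_takeUntil_subset_edges hv' ht) hcase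
        · refine ⟨w₂, ⟨h₂, hcase _ (SimpleGraph.Walk.end_mem_support _)⟩, ?_⟩
          exact hwalk W _ (fun t ht => P.support_dropUntil_subset_support hv' ht)
            (fun t ht => P.edges_dropUntil_subset_edges hv' ht) hcase
    intro u hu v hv
    obtain ⟨b, hb, hub⟩ := reach u hu
    obtain ⟨c, hc, hvc⟩ := reach v hv
    exact (hub.trans (aux_mono (hBW b hb c hc) (hmono W))).trans (hsymm _ _ _ hvc)
  obtain ⟨hc, ha, hmax⟩ := hB
  have hH1 : H.Connected := ⟨⟨w₁, Or.inl h₁⟩, hconn ∅ hc.2 (by simp)⟩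
  have hH2 : ∀ w, ¬ H.IsArticulation w := by
    rintro w ⟨-, hw⟩
    apply hw
    apply hconn
    · by_cases hwB : w ∈ B.verts
      · by_contra h
        exact ha w ⟨hwB, h⟩
      · intro u hu v hv
        refine aux_mono (hc.2 u ⟨hu.1, by simp⟩ v ⟨hv.1, by simp⟩) ?_
        rintro a b ⟨k1, k2, -, -, k⟩
        exact ⟨k1, k2, fun h => hwB (h ▸ k1), fun h => hwB (h ▸ k2), k⟩
    · rintro v - - t rfl t' rfl
      rfl
  have := (hmax H hH1 hH2 (fun _ h => Or.inl h) (fun _ h => Or.inl h)).1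
  intro v hv
  rw [this]
  exact Or.inr hv

end RNA

/-- Let `B` be a block of the dual graph of an RNA secondary
structure representing a pseudoknot (some vertex of `B` has degree at least
3), and let `[i, j]` be the region of the primary sequence spanned by the
stems of `B`.  If the pseudoknot is recursive, then `B` has edge-connectivity
exactly 2. -/
theorem recursive_pseudoknot_block_has_edge_connectivity_two {n : ℕ}
    (R : RNA n) (B : Multigraph.Subgraph R.dualGraph) (hB : B.IsBlock)
    (hPK : ∃ u ∈ B.verts, 3 ≤ B.degree u)
    (i j : ℕ)
    (hi : ∃ S ∈ B.verts, S.MemPos i) (hj : ∃ S ∈ B.verts, S.MemPos j)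
    (hspan : ∀ S ∈ B.verts, ∀ p : ℕ, S.MemPos p → i ≤ p ∧ p ≤ j)
    (hrec : R.RecursivePK i j) :
    B.EdgeConnTwo := by
  classical
  obtain ⟨hc, ha, hmax⟩ := id hB
  obtain ⟨k, l, hik, hkl, hlj, ⟨a, b, hab, hka, hbl⟩, hcl⟩ := hrec
  have hab' := R.fst_lt_snd _ hab
  simp only at hab'
  -- closedness for pairs of stems in B
  have hclB : ∀ S ∈ B.verts, ∀ t ≤ S.r,
      ((k ≤ S.i + t ∧ S.i + t ≤ l) ↔ (k ≤ S.j - t ∧ S.j - t ≤ l)) := by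
    intro S hS t ht
    have hp := S.nested t ht
    have s1 := hspan S hS (S.i + t) ⟨t, ht, Or.inl rfl⟩
    have s2 := hspan S hS (S.j - t) ⟨t, ht, Or.inr rfl⟩
    constructor
    · rintro ⟨g1, g2⟩
      exact hcl _ _ (Or.inr hp) g1 g2 s2.1 s2.2
    · rintro ⟨g1, g2⟩
      exact hcl _ _ (Or.inl hp) g1 g2 s1.1 s1.2
  by_cases hcut : ∃ S ∈ B.verts, (∃ p, S.MemPos p ∧ k ≤ p ∧ p ≤ l) ∧
      (∃ p, S.MemPos p ∧ ¬ (k ≤ p ∧ p ≤ l))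
  · have hprop : ∀ S ∈ B.verts, (∃ p, S.MemPos p ∧ k ≤ p ∧ p ≤ l) →
        (∃ p, S.MemPos p ∧ ¬ (k ≤ p ∧ p ≤ l)) →
        S.i < k ∧ k ≤ S.i + S.r ∧ S.j - S.r ≤ l ∧ l < S.j := by
      rintro S hS ⟨p, ⟨t, ht, hp⟩, hpkl⟩ ⟨p', ⟨t', ht', hp'⟩, hpkl'⟩
      have h1 := hclB S hS t ht
      have h2 := hclB S hS t' ht'
      have := S.sep
      rcases hp with rfl | rfl <;> rcases hp' with rfl | rfl <;> omega
    obtain ⟨S, hS, hin, hout⟩ := hcut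
    have hSk := hprop S hS hin hout
    have hsep := S.sep
    refine RNA.stem_case B hc ha hPK S hS fun T hT hTS => ?_
    have hdis : ∀ p, T.MemPos p → ¬ S.MemPos p := fun p hp hp' =>
      hTS (RNA.Stem.eq_of_memPos hp hp')
    by_cases hTin : ∃ p, T.MemPos p ∧ k ≤ p ∧ p ≤ l
    · by_cases hTout : ∃ p, T.MemPos p ∧ ¬ (k ≤ p ∧ p ≤ l)
      · exfalso
        have hTk := hprop T hT hTin hTout
        exact hdis k ((T.memPos_iff k).2 (by omega)) ((S.memPos_iff k).2 (by omega))
      · left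
        intro p hp
        have h1 := hdis p hp
        rw [RNA.Stem.memPos_iff] at h1
        have h2 : k ≤ p ∧ p ≤ l := by
          by_contra h
          exact hTout ⟨p, hp, h⟩
        omega
    · right
      intro p hp
      have h1 := hdis p hp
      rw [RNA.Stem.memPos_iff] at h1
      have h2 : ¬ (k ≤ p ∧ p ≤ l) := fun h => hTin ⟨p, hp, h⟩
      omega
  by_cases htouch : ∃ S ∈ B.verts, ∃ p, S.MemPos p ∧ k ≤ p ∧ p ≤ l
  · refine RNA.interval_cut B hc ha hPK k l {S | ∃ p, S.MemPos p ∧ k ≤ p ∧ p ≤ l} ?_ ?_ htouch ?_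
    · intro S hS hSU p hp
      by_contra h
      exact hcut ⟨S, hS, hSU, p, hp, h⟩
    · intro S hS hSU p hp h
      exact hSU ⟨p, hp, h⟩
    · obtain ⟨S, hS, hSi⟩ := hi
      refine ⟨S, hS, fun hSU => hcut ⟨S, hS, hSU, i, hSi, by omega⟩⟩
  -- no stem of B meets [k, l]
  let Q : ℕ → Prop := fun p => ∃ S ∈ B.verts, S.MemPos p
  have hQ : ∀ p, k ≤ p → p ≤ l → ¬ Q p := by
    rintro p h1 h2 ⟨S, hS, hp⟩
    exact htouch ⟨S, hS, p, hp, h1, h2⟩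
  have hex : ∃ p, k ≤ p ∧ Q p := ⟨j, by omega, hj⟩
  obtain ⟨p₂, hp₂, hQ₂, hmin⟩ : ∃ p₂, l < p₂ ∧ Q p₂ ∧ ∀ t, k ≤ t → t < p₂ → ¬ Q t := by
    have hs := Nat.find_spec hex
    refine ⟨Nat.find hex, ?_, hs.2, fun t ht htl hQt => Nat.find_min hex htl ⟨ht, hQt⟩⟩
    by_contra h
    exact hQ _ hs.1 (by omega) hs.2
  obtain ⟨p₁, hp₁, hQ₁, hgr⟩ : ∃ p₁, p₁ < k ∧ Q p₁ ∧ ∀ t, p₁ < t → t < k → ¬ Q t := by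
    have h1 : Q (Nat.findGreatest Q (k - 1)) :=
      Nat.findGreatest_spec (P := Q) (m := i) (by omega) hi
    have h2 : Nat.findGreatest Q (k - 1) ≤ k - 1 := Nat.findGreatest_le _
    exact ⟨_, by omega, h1, fun t ht1 ht2 => Nat.findGreatest_is_greatest ht1 (by omega)⟩
  have hgap : ∀ t, p₁ < t → t < p₂ → ¬ Q t := by
    intro t h1 h2
    by_cases h : t < k
    · exact hgr t h1 h
    · exact hmin t (by omega) h2
  obtain ⟨w₁, hw₁, hm₁⟩ := hQ₁
  obtain ⟨w₂, hw₂, hm₂⟩ := hQ₂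
  have hww : w₁ = w₂ := by
    by_contra hne
    obtain ⟨P, hP⟩ := (RNA.segGraph_reachable (y := p₂) hm₁ p₂ (by omega) le_rfl w₂ hm₂).exists_isPath
    have hear := RNA.ear B hB hw₁ hw₂ P hP
    cases P with
    | nil => exact hne rfl
    | cons hadj P' =>
      rename_i v
      have hv : v ∈ B.verts := hear v (by simp)
      obtain ⟨e, he1, he2, he3⟩ := hadj
      have he4 : s(e.src, e.tgt) = s(w₁, v) := he3
      have hpq := e.seg.1
      have hap : R.Paired a := ⟨b, Or.inl hab⟩
      have hsv : e.src ∈ B.verts ∧ e.tgt ∈ B.verts := by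
        rw [Sym2.eq_iff] at he4
        rcases he4 with ⟨h1, h2⟩ | ⟨h1, h2⟩ <;> rw [h1, h2] <;> exact ⟨by assumption, by assumption⟩
      have g1 : e.p = p₁ := by
        by_contra h
        exact hgap e.p (by omega) (by omega) ⟨_, hsv.1, e.mem_src⟩
      have g2 : e.q = p₂ := by
        by_contra h
        exact hgap e.q (by omega) (by omega) ⟨_, hsv.2, e.mem_tgt⟩
      exact e.seg.2.2.2 a (by omega) (by omega) hap
  subst hww
  have hgw : ∀ t, p₁ < t → t < p₂ → ¬ w₁.MemPos t := fun t h1 h2 h => hgap t h1 h2 ⟨w₁, hw₁, h⟩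
  have hsep := w₁.sep
  have hloc : p₁ = w₁.i + w₁.r ∧ p₂ = w₁.j - w₁.r := by
    have q1 := hgw (p₁ + 1) (by omega) (by omega)
    have q2 := hgw (p₂ - 1) (by omega) (by omega)
    rw [RNA.Stem.memPos_iff] at q1 q2 hm₁ hm₂
    omega
  refine RNA.stem_case B hc ha hPK w₁ hw₁ fun T hT hTS => Or.inr fun p hp => ?_
  have h1 : ¬ w₁.MemPos p := fun h => hTS (RNA.Stem.eq_of_memPos hp h)
  have h2 : ¬ (p₁ < p ∧ p < p₂) := fun h => hgap p h.1 h.2 ⟨T, hT, hp⟩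
  rw [RNA.Stem.memPos_iff] at h1
  omega
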